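/- Let p be a prime and let α be a nonzero real number. Then the set B_α = [0,|α|) × ℤ_p is a fundamental domain for the subgroup ψ_α(ℤ[1/p]) = {(αq, q) : q ∈ ℤ[1/p]} of ℝ × ℚ_p: for every (x, y) ∈ ℝ × ℚ_p there exist a unique b ∈ [0,|α|), a unique z ∈ ℤ_p and a unique q ∈ ℤ[1/p] such that (x, y) = (b + αq, z + q), where q is viewed in ℚ_p via the canonical embedding ℚ → ℚ_p. -/

import Mathlib

theorem Padic.exists_norm_sub_div_pow_le_one (p : ℕ) [Fact p.Prime] (y : ℚ_[p]) :
    ∃ (a : ℤ) (k : ℕ), ‖y - (a : ℚ_[p]) / (p : ℚ_[p]) ^ k‖ ≤ 1 := by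
  have hp : (1 : ℝ) < p := by exact_mod_cast (Fact.out : p.Prime).one_lt
  obtain ⟨k, hk⟩ := pow_unbounded_of_one_lt ‖y‖ hp
  have hpk : (0 : ℝ) < (p : ℝ) ^ k := by positivity
  have hp0 : (p : ℚ_[p]) ^ k ≠ 0 :=
    pow_ne_zero _ (by exact_mod_cast (Fact.out : p.Prime).ne_zero)
  have hw : ‖(p : ℚ_[p]) ^ k * y‖ ≤ 1 := by
    rw [norm_mul, norm_pow, Padic.norm_p, inv_pow, inv_mul_le_iff₀ hpk, mul_one]
    exact hk.le
  let w : ℤ_[p] := ⟨(p : ℚ_[p]) ^ k * y, hw⟩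
  have hn := (PadicInt.norm_le_pow_iff_mem_span_pow _ k).2 (PadicInt.appr_spec k w)
  rw [PadicInt.norm_def] at hn
  refine ⟨w.appr k, k, ?_⟩
  have e : y - ((w.appr k : ℤ) : ℚ_[p]) / (p : ℚ_[p]) ^ k =
      ((w - (w.appr k : ℤ_[p]) : ℤ_[p]) : ℚ_[p]) / (p : ℚ_[p]) ^ k := by
    rw [PadicInt.coe_sub, PadicInt.coe_natCast]
    simp only [w, Int.cast_natCast]
    field_simp
  rw [e, norm_div, norm_pow, Padic.norm_p, inv_pow, div_inv_eq_mul]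
  calc _ ≤ (p : ℝ) ^ (-k : ℤ) * (p : ℝ) ^ k := by gcongr
    _ = 1 := by rw [zpow_neg, zpow_natCast, inv_mul_cancel₀ hpk.ne']

theorem Padic.exists_int_eq_div_pow_of_norm_le_one (p : ℕ) [Fact p.Prime] (a : ℤ) (k : ℕ)
    (h : ‖(((a : ℚ) / (p : ℚ) ^ k : ℚ) : ℚ_[p])‖ ≤ 1) :
    ∃ n : ℤ, (a : ℚ) / (p : ℚ) ^ k = n := by
  have hp : 0 < p := (Fact.out : p.Prime).pos
  have hpk : (0 : ℝ) < (p : ℝ) ^ k := by positivity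
  push_cast at h
  rw [norm_div, norm_pow, Padic.norm_p, inv_pow, div_inv_eq_mul, ← le_div_iff₀ hpk, one_div,
    ← zpow_natCast, ← zpow_neg, Padic.norm_int_le_pow_iff_dvd] at h
  obtain ⟨n, rfl⟩ := h
  refine ⟨n, ?_⟩
  have : (p : ℚ) ^ k ≠ 0 := by positivity
  push_cast
  field_simp

theorem exists_int_sub_mul_mem_Ico {α : ℝ} (hα : α ≠ 0) (t : ℝ) :
    ∃ n : ℤ, t - α * n ∈ Set.Ico (0 : ℝ) |α| := by
  obtain ⟨m, hm, -⟩ := existsUnique_sub_zsmul_mem_Ico (abs_pos.2 hα) t 0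
  rw [zero_add, zsmul_eq_mul] at hm
  rcases abs_choice α with h | h
  · refine ⟨m, ?_⟩
    rwa [mul_comm, show (m : ℝ) * α = m * |α| by rw [h]]
  · refine ⟨-m, ?_⟩
    rwa [show α * ((-m : ℤ) : ℝ) = m * |α| by rw [h]; push_cast; ring]


/-- For a prime `p` and a nonzero real `α`, the set
`B_α = [0,|α|) × ℤ_p` is a fundamental domain for
`ψ_α(ℤ[1/p]) = {(αq, q) : q ∈ ℤ[1/p]}` in `ℝ × ℚ_p`: every `(x, y) ∈ ℝ × ℚ_p` has a
unique decomposition `(x, y) = (b + αq, z + q)` with `b ∈ [0,|α|)`, `z ∈ ℤ_p` and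
`q ∈ ℤ[1/p]`. -/
theorem statement2 (p : ℕ) [Fact p.Prime] (α : ℝ) (hα : α ≠ 0) (x : ℝ × ℚ_[p]) :
    ∃! bzq : ℝ × ℤ_[p] × ℚ,
      bzq.1 ∈ Set.Ico (0 : ℝ) |α| ∧
      (∃ (a : ℤ) (k : ℕ), bzq.2.2 = (a : ℚ) / (p : ℚ) ^ k) ∧
      x = (bzq.1 + α * (bzq.2.2 : ℝ), (bzq.2.1 : ℚ_[p]) + ((bzq.2.2 : ℚ) : ℚ_[p])) := by
  have hp : (p : ℚ) ≠ 0 := by exact_mod_cast (Fact.out : p.Prime).ne_zero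
  obtain ⟨x₁, y⟩ := x
  obtain ⟨a, k, hak⟩ := Padic.exists_norm_sub_div_pow_le_one p y
  obtain ⟨n, hn⟩ := exists_int_sub_mul_mem_Ico hα (x₁ - α * (a / (p : ℝ) ^ k))
  have hz : ‖y - (a : ℚ_[p]) / (p : ℚ_[p]) ^ k - n‖ ≤ 1 :=
    sub_eq_add_neg _ (n : ℚ_[p]) ▸ (Padic.nonarchimedean _ _).trans
      (max_le hak ((norm_neg _).trans_le (Padic.norm_int_le_one n)))
  refine existsUnique_of_exists_of_unique
    ⟨(x₁ - α * (a / (p : ℝ) ^ k) - α * n, ⟨_, hz⟩, a / (p : ℚ) ^ k + n), hn,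
      ⟨a + n * p ^ k, k, ?_⟩, ?_⟩ ?_
  · push_cast
    field_simp
  · ext <;> push_cast <;> ring
  · rintro ⟨b, z, q⟩ ⟨b', z', q'⟩ ⟨hb, ⟨c, l, hq⟩, h⟩ ⟨hb', ⟨c', l', hq'⟩, h'⟩
    dsimp only at hb hb' hq hq' h h'
    rw [h, Prod.mk.injEq] at h'
    obtain ⟨h₁, h₂⟩ := h'
    have hsub : q - q' = ((c * p ^ l' - c' * p ^ l : ℤ) : ℚ) / (p : ℚ) ^ (l + l') := by
      rw [hq, hq', pow_add]
      push_cast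
      field_simp
    have hnorm : ‖((q - q' : ℚ) : ℚ_[p])‖ ≤ 1 := by
      have : ((q - q' : ℚ) : ℚ_[p]) = ((z' - z : ℤ_[p]) : ℚ_[p]) := by
        push_cast
        linear_combination h₂
      rw [this]
      exact PadicInt.norm_le_one _
    rw [hsub] at hnorm
    obtain ⟨m, hm⟩ := Padic.exists_int_eq_div_pow_of_norm_le_one p _ _ hnorm
    rw [← hsub] at hm
    have hmR : (q : ℝ) - q' = m := by exact_mod_cast congrArg (Rat.cast (K := ℝ)) hm
    have hlt : |α| * |(m : ℝ)| < |α| * 1 := by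
      rw [← abs_mul, ← hmR, show α * ((q : ℝ) - q') = b' - b by linear_combination h₁, mul_one,
        abs_lt]
      constructor <;> linarith [hb.1, hb.2, hb'.1, hb'.2]
    have hm0 : m = 0 := by
      have := lt_of_mul_lt_mul_left hlt (abs_nonneg α)
      exact Int.abs_lt_one_iff.1 (by exact_mod_cast this)
    have hqq : q = q' := by
      rw [hm0, Int.cast_zero] at hm
      exact sub_eq_zero.1 hm
    subst hqq
    rw [add_left_inj] at h₁ h₂
    rw [h₁, Subtype.ext h₂]
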